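/- Let 1 < p ≤ q < ∞, r ∈ [p,∞), let 𝒮 be an η-sparse collection of dyadic cubes in ℝⁿ, and let ω, σ be weights on ℝⁿ. Then there is a constant C depending only on p, q, r such that for all nonnegative real numbers (c_Q)_{Q∈𝒮} and all measurable f: ℝⁿ → [0,∞): ‖Σ_{Q∈𝒮} c_Q (∫_Q fσ)^r 1_Q‖_{L^{q/r}_ω} ≤ C · ( sup_{R∈𝒮} σ(R)^{−r/p} ‖Σ_{Q∈𝒮, Q⊆R} c_Q σ(Q)^r 1_Q‖_{L^{q/r}_ω} ) · ‖f‖^r_{L^p_σ}. -/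

import Mathlib

open MeasureTheory ENNReal Set

noncomputable section

/-- An axis-parallel (closed) cube in ℝⁿ with corner `corner` and side length `side > 0`. -/
structure Cube (n : ℕ) where
  corner : Fin n → ℝ
  side : ℝ
  side_pos : 0 < side

namespace Cube

/-- The set of points of the cube. -/
def carrier {n : ℕ} (Q : Cube n) : Set (Fin n → ℝ) :=
  {x | ∀ i, Q.corner i ≤ x i ∧ x i ≤ Q.corner i + Q.side}

/-- The volume `|Q|` of the cube. -/
def vol {n : ℕ} (Q : Cube n) : ℝ := Q.side ^ n

/-- `Q` is a cube of the standard dyadic grid: `Q = 2^{-j}([0,1]^n + m)`. -/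
def IsDyadic {n : ℕ} (Q : Cube n) : Prop :=
  ∃ (j : ℤ) (m : Fin n → ℤ),
    Q.side = (2 : ℝ) ^ (-j) ∧ ∀ i, Q.corner i = (m i : ℝ) * (2 : ℝ) ^ (-j)

end Cube

/-- `η`-sparseness of a collection of cubes: there are pairwise disjoint measurable
subsets `E Q ⊆ Q` with `|E Q| ≥ η |Q|`. -/
def IsSparse {n : ℕ} (η : ℝ) (S : Set (Cube n)) : Prop :=
  ∃ E : Cube n → Set (Fin n → ℝ),
    (∀ Q ∈ S, MeasurableSet (E Q)) ∧ (∀ Q ∈ S, E Q ⊆ Q.carrier) ∧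
    (S.Pairwise (fun Q Q' => Disjoint (E Q) (E Q'))) ∧
    (∀ Q ∈ S, ENNReal.ofReal (η * Q.vol) ≤ volume (E Q))

/-- A weight: a nonnegative locally integrable function on ℝⁿ. -/
def IsWeight {n : ℕ} (w : (Fin n → ℝ) → ℝ) : Prop :=
  MeasureTheory.LocallyIntegrable w volume ∧ ∀ x, 0 ≤ w x

/-- `ω(Q) = ∫_Q ω`. -/
def wMass {n : ℕ} (w : (Fin n → ℝ) → ℝ) (Q : Cube n) : ℝ≥0∞ :=
  ∫⁻ x in Q.carrier, ENNReal.ofReal (w x)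

/-- The weighted `L^s` (quasi)norm `‖f‖_{L^s_w} = (∫ |f|^s w)^{1/s}`, valued in `ℝ≥0∞`. -/
def wNorm {n : ℕ} (s : ℝ) (w f : (Fin n → ℝ) → ℝ) : ℝ≥0∞ :=
  (∫⁻ x, ENNReal.ofReal (|f x| ^ s) * ENNReal.ofReal (w x)) ^ (1 / s)

/-- The weighted `L^s` (quasi)norm of an `ℝ≥0∞`-valued function. -/
def eNorm {n : ℕ} (s : ℝ) (w : (Fin n → ℝ) → ℝ) (g : (Fin n → ℝ) → ℝ≥0∞) : ℝ≥0∞ :=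
  (∫⁻ x, g x ^ s * ENNReal.ofReal (w x)) ^ (1 / s)

/-- `Σ_{Q ∈ D} g(Q) 1_Q`. -/
def cubeSum {n : ℕ} (D : Set (Cube n)) (g : Cube n → ℝ≥0∞) (x : Fin n → ℝ) : ℝ≥0∞ :=
  ∑' Q : D, Q.1.carrier.indicator (fun _ => g Q.1) x

/-- The sparse operator `A^{r,α}_S f = (Σ_{Q∈S} (|Q|^{-α} ∫_Q f)^r 1_Q)^{1/r}`
(for nonnegative `f`; negative values are truncated). -/
def sparseOp {n : ℕ} (S : Set (Cube n)) (r α : ℝ) (f : (Fin n → ℝ) → ℝ)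
    (x : Fin n → ℝ) : ℝ≥0∞ :=
  (cubeSum S
      (fun Q => ((ENNReal.ofReal Q.vol) ^ (-α) * ∫⁻ y in Q.carrier, ENNReal.ofReal (f y)) ^ r)
      x) ^ (1 / r)

/-- The Hardy–Littlewood maximal function over axis-parallel cubes. -/
def maximal {n : ℕ} (w : (Fin n → ℝ) → ℝ) (x : Fin n → ℝ) : ℝ≥0∞ :=
  ⨆ (Q : Cube n) (_ : x ∈ Q.carrier),
    (ENNReal.ofReal Q.vol)⁻¹ * ∫⁻ y in Q.carrier, ENNReal.ofReal |w y|

/-- The Fujii–Wilson `A∞`-characteristic `[w]_{A∞} = sup_Q ω(Q)⁻¹ ∫_Q M(1_Q ω)`. -/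
def AinfChar {n : ℕ} (w : (Fin n → ℝ) → ℝ) : ℝ≥0∞ :=
  ⨆ Q : Cube n, (wMass w Q)⁻¹ * ∫⁻ x in Q.carrier, maximal (Q.carrier.indicator w) x

/-- The two-weight characteristic
`[ω,σ]_{A^α_{pq}(S)} = sup_{Q∈S} |Q|^{-α} ω(Q)^{1/q} σ(Q)^{1/p'}` (here `1/p' = 1 - 1/p`). -/
def twoWeightChar {n : ℕ} (p q α : ℝ) (S : Set (Cube n)) (w σ' : (Fin n → ℝ) → ℝ) : ℝ≥0∞ :=
  ⨆ Q ∈ S, (ENNReal.ofReal Q.vol) ^ (-α) * wMass w Q ^ (1 / q) * wMass σ' Q ^ (1 - 1 / p)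

/-- The one-weight characteristic
`[w]_{A_{pq}} = sup_Q (|Q|⁻¹ ∫_Q w^q)(|Q|⁻¹ ∫_Q w^{-p'})^{q/p'}`, `p' = p/(p-1)`. -/
def ApqChar {n : ℕ} (p q : ℝ) (w : (Fin n → ℝ) → ℝ) : ℝ≥0∞ :=
  ⨆ Q : Cube n,
    ((ENNReal.ofReal Q.vol)⁻¹ * ∫⁻ x in Q.carrier, (ENNReal.ofReal (w x)) ^ q) *
      ((ENNReal.ofReal Q.vol)⁻¹ *
          ∫⁻ x in Q.carrier, (ENNReal.ofReal (w x)) ^ (-(p / (p - 1)))) ^ (q / (p / (p - 1)))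

/-- The testing constant `𝒯`. -/
def testT {n : ℕ} (p q r α : ℝ) (S : Set (Cube n)) (w σ' : (Fin n → ℝ) → ℝ) : ℝ≥0∞ :=
  ⨆ R ∈ S,
    wMass σ' R ^ (-(r / p)) *
      eNorm (q / r) w
        (cubeSum {Q | Q ∈ S ∧ Q.carrier ⊆ R.carrier}
          (fun Q => (ENNReal.ofReal Q.vol) ^ (-(α * r)) * wMass σ' Q ^ r))

/-- The testing constant `𝒯*`; here `1/(q/r)' = 1 - r/q` and `(p/r)' = (p/r)/((p/r)-1)`. -/
def testTstar {n : ℕ} (p q r α : ℝ) (S : Set (Cube n)) (w σ' : (Fin n → ℝ) → ℝ) : ℝ≥0∞ :=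
  ⨆ R ∈ S,
    wMass w R ^ (-(1 - r / q)) *
      eNorm ((p / r) / (p / r - 1)) σ'
        (cubeSum {Q | Q ∈ S ∧ Q.carrier ⊆ R.carrier}
          (fun Q => (ENNReal.ofReal Q.vol) ^ (-(α * r)) * wMass σ' Q ^ (r - 1) * wMass w Q))

/-- The operator (quasi)norm of `A^{r,α}_S(·σ) : L^p_σ → L^q_ω`, i.e. the least constant `K`
with `‖A^{r,α}_S(fσ)‖_{L^q_ω} ≤ K ‖f‖_{L^p_σ}` for all `f`. -/
def sparseOpNorm {n : ℕ} (p q r α : ℝ) (S : Set (Cube n)) (w σ' : (Fin n → ℝ) → ℝ) : ℝ≥0∞ :=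
  sInf {K : ℝ≥0∞ | ∀ f : (Fin n → ℝ) → ℝ, Measurable f →
    eNorm q w (sparseOp S r α (fun y => f y * σ' y)) ≤ K * wNorm p σ' f}

theorem ENNReal.sum_rpow_le_rpow_sum {ι : Type*} (P : Finset ι) (x : ι → ℝ≥0∞) {θ : ℝ}
    (hθ : 1 ≤ θ) : ∑ i ∈ P, x i ^ θ ≤ (∑ i ∈ P, x i) ^ θ := by
  classical
  induction P using Finset.induction_on with
  | empty => simp
  | insert a P ha ih =>
    rw [Finset.sum_insert ha, Finset.sum_insert ha]
    exact (add_le_add_right ih _).trans (ENNReal.add_rpow_le_rpow_add _ _ hθ)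

theorem ENNReal.rpow_sum_le_sum_rpow {ι : Type*} (P : Finset ι) (x : ι → ℝ≥0∞) {θ : ℝ}
    (hθ : 0 < θ) (hθ' : θ ≤ 1) : (∑ i ∈ P, x i) ^ θ ≤ ∑ i ∈ P, x i ^ θ := by
  classical
  induction P using Finset.induction_on with
  | empty => simp [hθ]
  | insert a P ha ih =>
    rw [Finset.sum_insert ha, Finset.sum_insert ha]
    exact (ENNReal.rpow_add_le_add_rpow _ _ hθ.le hθ').trans (add_le_add_right ih _)

theorem MeasureTheory.lintegral_Lp_sum_le {α ι : Type*} [MeasurableSpace α] {μ : Measure α}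
    (P : Finset ι) {u : ι → α → ℝ≥0∞} (hu : ∀ i ∈ P, Measurable (u i)) {s : ℝ} (hs : 1 ≤ s) :
    (∫⁻ x, (∑ i ∈ P, u i x) ^ s ∂μ) ^ (1 / s) ≤ ∑ i ∈ P, (∫⁻ x, u i x ^ s ∂μ) ^ (1 / s) := by
  classical
  induction P using Finset.induction_on with
  | empty =>
    have : 0 < s := by linarith
    simp [this]
  | insert a P ha ih =>
    simp_rw [Finset.sum_insert ha]
    have hP : ∀ i ∈ P, Measurable (u i) := fun i hi => hu i (Finset.mem_insert_of_mem hi)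
    have := lintegral_Lp_add_le (μ := μ) (hu a (Finset.mem_insert_self _ _)).aemeasurable
      (Finset.measurable_sum P hP).aemeasurable hs
    simp only [Pi.add_apply] at this
    exact this.trans (add_le_add_right (ih hP) _)

/-- Summation of finitely many functions whose `L^{q/r}` quasinorms are controlled by
`x i ^ (r / p)`, for `p ≤ q` and `p ≤ r`. -/
theorem lintegral_rpow_sum_le_of_forall_le {α ι : Type*} [MeasurableSpace α] {μ : Measure α}
    {p q r : ℝ} (hp : 1 < p) (hpq : p ≤ q) (hpr : p ≤ r) (P : Finset ι) {u : ι → α → ℝ≥0∞}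
    (hu : ∀ i ∈ P, Measurable (u i)) (T : ℝ≥0∞) (x : ι → ℝ≥0∞)
    (h : ∀ i ∈ P, (∫⁻ y, u i y ^ (q / r) ∂μ) ^ (1 / (q / r)) ≤ T * x i ^ (r / p)) :
    (∫⁻ y, (∑ i ∈ P, u i y) ^ (q / r) ∂μ) ^ (1 / (q / r)) ≤ T * (∑ i ∈ P, x i) ^ (r / p) := by
  have hp0 : 0 < p := by linarith
  have hq0 : 0 < q := by linarith
  have hr0 : 0 < r := by linarith
  have hs0 : 0 < q / r := by positivity
  rcases le_total 1 (q / r) with hs | hs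
  · calc _ ≤ ∑ i ∈ P, (∫⁻ y, u i y ^ (q / r) ∂μ) ^ (1 / (q / r)) := lintegral_Lp_sum_le P hu hs
      _ ≤ ∑ i ∈ P, T * x i ^ (r / p) := Finset.sum_le_sum h
      _ = T * ∑ i ∈ P, x i ^ (r / p) := by rw [Finset.mul_sum]
      _ ≤ _ := by
        gcongr
        exact ENNReal.sum_rpow_le_rpow_sum _ _ ((one_le_div hp0).2 hpr)
  · rw [one_div, ENNReal.rpow_inv_le_iff hs0]
    have key : ∀ z : ℝ≥0∞, (T * z ^ (r / p)) ^ (q / r) = T ^ (q / r) * z ^ (q / p) := by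
      intro z
      rw [ENNReal.mul_rpow_of_nonneg _ _ hs0.le, ← ENNReal.rpow_mul]
      congr 2
      field_simp
    rw [key]
    calc _ ≤ ∫⁻ y, ∑ i ∈ P, u i y ^ (q / r) ∂μ :=
          lintegral_mono fun y => ENNReal.rpow_sum_le_sum_rpow _ _ hs0 hs
      _ = ∑ i ∈ P, ∫⁻ y, u i y ^ (q / r) ∂μ :=
          lintegral_finsetSum' _ fun i hi => ((hu i hi).pow_const _).aemeasurable
      _ ≤ ∑ i ∈ P, T ^ (q / r) * x i ^ (q / p) := by
          refine Finset.sum_le_sum fun i hi => ?_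
          rw [← key, ← ENNReal.rpow_inv_le_iff hs0, ← one_div]
          exact h i hi
      _ = T ^ (q / r) * ∑ i ∈ P, x i ^ (q / p) := by rw [Finset.mul_sum]
      _ ≤ _ := by
        gcongr
        exact ENNReal.sum_rpow_le_rpow_sum _ _ ((one_le_div hp0).2 hpq)

/-- Geometric sum over the dyadic levels below `t`. -/
theorem ENNReal.sum_two_zpow_rpow_le {a : ℝ} (ha : 0 < a) (K : Finset ℤ) (t : ℝ≥0∞) :
    ∑ k ∈ K, (if (2 : ℝ≥0∞) ^ k < t then ((2 : ℝ≥0∞) ^ k) ^ a else 0)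
      ≤ (1 - (2⁻¹ : ℝ≥0∞) ^ a)⁻¹ * t ^ a := by
  rcases eq_or_ne t 0 with rfl | ht0
  · simp
  rcases eq_or_ne t ⊤ with rfl | htop
  · rw [ENNReal.top_rpow_of_pos ha, ENNReal.mul_top]
    · exact le_top
    · simp
  obtain ⟨m, hm1, hm2⟩ := ENNReal.exists_mem_Ioc_zpow ht0 htop (y := 2) (by norm_num) (by norm_num)
  rw [← Finset.sum_filter]
  have hle : ∀ k ∈ K.filter (fun k => (2 : ℝ≥0∞) ^ k < t), k ≤ m := by
    intro k hk
    by_contra! hlt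
    have : (2 : ℝ≥0∞) ^ (m + 1) ≤ 2 ^ k :=
      ENNReal.zpow_le_of_le (by norm_num) (by omega)
    exact absurd ((Finset.mem_filter.1 hk).2.trans_le (hm2.trans this)) (lt_irrefl _)
  have hterm : ∀ k ∈ K.filter (fun k => (2 : ℝ≥0∞) ^ k < t),
      ((2 : ℝ≥0∞) ^ k) ^ a = ((2⁻¹ : ℝ≥0∞) ^ a) ^ (m - k).toNat * ((2 : ℝ≥0∞) ^ m) ^ a := by
    intro k hk
    rw [← ENNReal.rpow_natCast, ← ENNReal.rpow_mul, mul_comm a, ENNReal.rpow_mul,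
      ENNReal.rpow_natCast, ← ENNReal.mul_rpow_of_nonneg _ _ ha.le]
    congr 1
    have hk' : ((m - k).toNat : ℤ) = m - k := Int.toNat_of_nonneg (sub_nonneg.2 (hle k hk))
    have h2 : (2⁻¹ : ℝ≥0∞) ^ (m - k).toNat = 2 ^ (k - m) := by
      rw [← ENNReal.inv_pow, ← zpow_natCast, hk', ← ENNReal.zpow_neg, neg_sub]
    rw [h2, ← ENNReal.zpow_add (by norm_num) (by norm_num)]
    congr 1
    ring
  rw [Finset.sum_congr rfl hterm, ← Finset.sum_mul]
  gcongr
  have hinj : Set.InjOn (fun k : ℤ => (m - k).toNat)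
      (K.filter (fun k => (2 : ℝ≥0∞) ^ k < t)) := by
    intro k hk l hl hkl
    have := hle k hk
    have := hle l hl
    simp only at hkl
    omega
  rw [← ENNReal.tsum_geometric, ← Finset.sum_image (f := fun n : ℕ => ((2⁻¹ : ℝ≥0∞) ^ a) ^ n) hinj]
  exact ENNReal.sum_le_tsum _

/-- Carleson-type bound: at level `2 ^ k` let `M k` be an almost disjoint family of sets over which
the average of `f` exceeds `2 ^ k`. -/
theorem sum_level_measure_le {α ι : Type*} [MeasurableSpace α] {σ : Measure α} {p : ℝ} (hp : 1 < p)
    {A : ι → Set α} (K : Finset ℤ) (M : ℤ → Finset ι) {f : α → ℝ≥0∞} (hf : Measurable f)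
    (hA : ∀ k, ∀ i ∈ M k, MeasurableSet (A i)) (hσ : ∀ k, ∀ i ∈ M k, σ (A i) ≠ ⊤)
    (hd : ∀ k, (M k : Set ι).Pairwise fun i j => AEDisjoint σ (A i) (A j))
    (hM : ∀ k, ∀ i ∈ M k, (2 : ℝ≥0∞) ^ k * σ (A i) ≤ ∫⁻ y in A i, f y ∂σ) :
    ∑ k ∈ K, ∑ i ∈ M k, ((2 : ℝ≥0∞) ^ (k - 1)) ^ p * σ (A i) ≤
      (1 - (2⁻¹ : ℝ≥0∞) ^ (p - 1))⁻¹ * ∫⁻ y, f y ^ p ∂σ := by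
  classical
  have hlev : ∀ k, MeasurableSet {y | (2 : ℝ≥0∞) ^ (k - 1 : ℤ) < f y} := fun k =>
    measurableSet_lt measurable_const hf
  have h2 : ∀ k : ℤ, (2 : ℝ≥0∞) ^ k = 2 ^ (k - 1) + 2 ^ (k - 1) := by
    intro k
    have := ENNReal.zpow_add (x := 2) (by norm_num) (by norm_num) (k - 1) 1
    rwa [sub_add_cancel, zpow_one, mul_two] at this
  have hfin : ∀ k : ℤ, (2 : ℝ≥0∞) ^ k ≠ ⊤ := fun k =>
    ENNReal.zpow_ne_top (by norm_num) (by norm_num) k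
  have hne : ∀ k : ℤ, (2 : ℝ≥0∞) ^ k ≠ 0 := fun k =>
    (ENNReal.zpow_pos (by norm_num) (by norm_num) k).ne'
  set g : ℤ → α → ℝ≥0∞ := fun k => {y | (2 : ℝ≥0∞) ^ (k - 1 : ℤ) < f y}.indicator f with hg
  have hgm : ∀ k, Measurable (g k) := fun k => hf.indicator (hlev k)
  have h1 : ∀ k, ∀ i ∈ M k, (2 : ℝ≥0∞) ^ (k - 1) * σ (A i) ≤ ∫⁻ y in A i, g k y ∂σ := by
    intro k i hi
    have hle : ∫⁻ y in A i, f y ∂σ ≤ ∫⁻ y in A i, g k y ∂σ + 2 ^ (k - 1) * σ (A i) := by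
      calc _ ≤ ∫⁻ y in A i, (g k y + 2 ^ (k - 1)) ∂σ := by
            refine lintegral_mono fun y => ?_
            by_cases hy : (2 : ℝ≥0∞) ^ (k - 1 : ℤ) < f y
            · simp [hg, hy]
            · simp only [hg, Set.indicator, Set.mem_ofPred_eq, hy, if_false, zero_add]
              exact not_lt.1 hy
        _ = _ := by
            rw [lintegral_add_left (hgm k), setLIntegral_const]
    have h3 := (hM k i hi).trans hle
    rw [h2, add_mul] at h3
    exact (ENNReal.add_le_add_iff_right (ENNReal.mul_ne_top (hfin _) (hσ k i hi))).1 h3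
  have h3 : ∀ k, ∑ i ∈ M k, (2 : ℝ≥0∞) ^ (k - 1) * σ (A i) ≤ ∫⁻ y, g k y ∂σ := by
    intro k
    refine (Finset.sum_le_sum (h1 k)).trans ?_
    rw [← lintegral_biUnion_finset₀ (hd k) (fun i hi => (hA k i hi).nullMeasurableSet)]
    exact setLIntegral_le_lintegral _ _
  calc _ = ∑ k ∈ K, ((2 : ℝ≥0∞) ^ (k - 1)) ^ (p - 1) *
        ∑ i ∈ M k, (2 : ℝ≥0∞) ^ (k - 1) * σ (A i) := by
        refine Finset.sum_congr rfl fun k _ => ?_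
        rw [Finset.mul_sum]
        refine Finset.sum_congr rfl fun i _ => ?_
        rw [← mul_assoc]
        congr 1
        conv_rhs => rw [← ENNReal.rpow_one ((2 : ℝ≥0∞) ^ (k - 1)), ← ENNReal.rpow_mul, one_mul]
        rw [← ENNReal.rpow_add _ _ (hne _) (hfin _)]
        congr 1; ring
    _ ≤ ∑ k ∈ K, ((2 : ℝ≥0∞) ^ (k - 1)) ^ (p - 1) * ∫⁻ y, g k y ∂σ := by
        gcongr with k
        exact h3 k
    _ = ∫⁻ y, ∑ k ∈ K, ((2 : ℝ≥0∞) ^ (k - 1)) ^ (p - 1) * g k y ∂σ := by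
        rw [lintegral_finsetSum _ fun k _ => (hgm k).const_mul _]
        refine Finset.sum_congr rfl fun k _ => ?_
        rw [lintegral_const_mul _ (hgm k)]
    _ ≤ ∫⁻ y, (1 - (2⁻¹ : ℝ≥0∞) ^ (p - 1))⁻¹ * f y ^ p ∂σ := by
        refine lintegral_mono fun y => ?_
        have h4 : ∑ k ∈ K, ((2 : ℝ≥0∞) ^ (k - 1)) ^ (p - 1) * g k y =
            (∑ k ∈ K.image (fun k => k - 1),
              (if (2 : ℝ≥0∞) ^ k < f y then ((2 : ℝ≥0∞) ^ k) ^ (p - 1) else 0)) * f y := by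
          rw [Finset.sum_image (by intro a _ b _ h; simpa using h), Finset.sum_mul]
          refine Finset.sum_congr rfl fun k _ => ?_
          by_cases hy : (2 : ℝ≥0∞) ^ (k - 1 : ℤ) < f y <;> simp [hg, hy]
        rw [h4]
        refine (mul_le_mul_left (ENNReal.sum_two_zpow_rpow_le (by linarith) _ _) _).trans ?_
        rw [mul_assoc]
        gcongr
        conv_lhs => rw [← ENNReal.rpow_one (f y), ← ENNReal.rpow_mul, one_mul]
        rw [← ENNReal.rpow_add_of_nonneg _ _ (by linarith) zero_le_one]
        apply le_of_eq
        congr 1; ring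
    _ = _ := lintegral_const_mul _ (hf.pow_const _)

/-- The testing theorem for a finite family of sets which are pairwise nested or almost disjoint. -/
theorem testing_bound_of_finset {α ι : Type*} [MeasurableSpace α] {σ ω : Measure α}
    {p q r : ℝ} (hp : 1 < p) (hpq : p ≤ q) (hpr : p ≤ r) (F : Finset ι) {A : ι → Set α}
    (hA : ∀ i ∈ F, MeasurableSet (A i)) (hinj : Set.InjOn A F) (hσ : ∀ i ∈ F, σ (A i) ≠ ⊤)
    (hnest : ∀ i ∈ F, ∀ j ∈ F, A i ⊆ A j ∨ A j ⊆ A i ∨ AEDisjoint σ (A i) (A j))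
    (c : ι → ℝ≥0∞) {f : α → ℝ≥0∞} (hf : Measurable f) (T : ℝ≥0∞)
    (hT : ∀ R ∈ F, (∫⁻ y, (∑ i ∈ F, {i | A i ⊆ A R}.indicator
      (fun i => (A i).indicator (fun _ => c i * σ (A i) ^ r) y) i) ^ (q / r) ∂ω) ^ (1 / (q / r))
        ≤ T * σ (A R) ^ (r / p)) :
    (∫⁻ y, (∑ i ∈ F, (A i).indicator (fun _ => c i * (∫⁻ z in A i, f z ∂σ) ^ r) y) ^ (q / r) ∂ω)
      ^ (1 / (q / r)) ≤
      ((4 : ℝ≥0∞) ^ p * (1 - (2⁻¹ : ℝ≥0∞) ^ (p - 1))⁻¹) ^ (r / p) * T *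
        (∫⁻ y, f y ^ p ∂σ) ^ (r / p) := by
  classical
  have hp0 : 0 < p := by linarith
  have hq0 : 0 < q := by linarith
  have hr0 : 0 < r := by linarith
  have hs0 : 0 < q / r := by positivity
  set G : ι → α → ℝ≥0∞ := fun R y => ∑ i ∈ F, {i | A i ⊆ A R}.indicator
      (fun i => (A i).indicator (fun _ => c i * σ (A i) ^ r) y) i with hG
  have hGm : ∀ R, Measurable (G R) := by
    intro R
    refine Finset.measurable_sum F fun i hi => ?_
    by_cases h : A i ⊆ A R
    · simpa [Set.indicator_of_mem, h] using measurable_const.indicator (hA i hi)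
    · simp [Set.indicator_of_notMem, h]
  have hI0 : ∀ i, σ (A i) = 0 → ∫⁻ z in A i, f z ∂σ = 0 := fun i h =>
    setLIntegral_measure_zero _ _ h
  have hC0 : ((4 : ℝ≥0∞) ^ p * (1 - (2⁻¹ : ℝ≥0∞) ^ (p - 1))⁻¹) ^ (r / p) ≠ 0 := by
    have h4 : (4 : ℝ≥0∞) ^ p ≠ 0 := (ENNReal.rpow_pos (by norm_num) (by norm_num)).ne'
    have h5 : (1 - (2⁻¹ : ℝ≥0∞) ^ (p - 1))⁻¹ ≠ 0 := by simp
    exact (ENNReal.rpow_pos_of_nonneg (pos_iff_ne_zero.2 (mul_ne_zero h4 h5)) (by positivity)).ne'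
  by_cases hN : ∫⁻ y, f y ^ p ∂σ = ⊤
  · rcases eq_or_ne T 0 with rfl | hT0
    · have hz : ∀ i ∈ F, ∀ᵐ y ∂ω,
          (A i).indicator (fun _ => c i * (∫⁻ z in A i, f z ∂σ) ^ r) y = 0 := by
        intro i hi
        have h1 := hT i hi
        rw [zero_mul, nonpos_iff_eq_zero,
          ENNReal.rpow_eq_zero_iff_of_pos (by positivity),
          lintegral_eq_zero_iff ((hGm i).pow_const _)] at h1
        filter_upwards [h1] with y hy
        by_cases hyA : y ∈ A i
        swap
        · simp [hyA]
        simp only [hG, Pi.zero_apply, ENNReal.rpow_eq_zero_iff_of_pos hs0,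
          Finset.sum_eq_zero_iff] at hy
        have := hy i hi
        simp only [Set.mem_ofPred_eq, subset_refl, Set.indicator_of_mem, hyA, mul_eq_zero,
          ENNReal.rpow_eq_zero_iff_of_pos hr0] at this ⊢
        exact this.imp id (hI0 i)
      have : ∀ᵐ y ∂ω, (∑ i ∈ F,
          (A i).indicator (fun _ => c i * (∫⁻ z in A i, f z ∂σ) ^ r) y) ^ (q / r) = 0 := by
        have := (Filter.eventually_all_finset F).2 hz
        filter_upwards [this] with y hy
        rw [Finset.sum_eq_zero hy, ENNReal.zero_rpow_of_pos hs0]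
      rw [lintegral_congr_ae this]
      simp [hq0, hr0]
    · rw [hN, ENNReal.top_rpow_of_pos (by positivity), ENNReal.mul_top (mul_ne_zero hC0 hT0)]
      exact le_top
  have hItop : ∀ i ∈ F, ∫⁻ z in A i, f z ∂σ ≠ ⊤ := by
    intro i hi
    refine ne_top_of_le_ne_top (ENNReal.add_ne_top.2 ⟨hσ i hi, hN⟩) ?_
    calc _ ≤ ∫⁻ z in A i, (1 + f z ^ p) ∂σ := by
          refine lintegral_mono fun z => ?_
          rcases le_total (f z) 1 with h | h
          · exact h.trans le_self_add
          · calc f z = f z ^ (1 : ℝ) := (ENNReal.rpow_one _).symm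
              _ ≤ f z ^ p := ENNReal.rpow_le_rpow_of_exponent_le h hp.le
              _ ≤ _ := le_add_self
      _ = σ (A i) + ∫⁻ z in A i, f z ^ p ∂σ := by
          rw [lintegral_add_left measurable_const, setLIntegral_const, one_mul]
      _ ≤ _ := by
        gcongr
        exact Measure.restrict_le_self
  -- the dyadic level of the average over each set
  have hlevel : ∀ i, ∃ k : ℤ, i ∈ F → ∫⁻ z in A i, f z ∂σ ≠ 0 →
      (2 : ℝ≥0∞) ^ k * σ (A i) < ∫⁻ z in A i, f z ∂σ ∧
        ∫⁻ z in A i, f z ∂σ ≤ (2 : ℝ≥0∞) ^ (k + 1) * σ (A i) := by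
    intro i
    by_cases hi : i ∈ F ∧ ∫⁻ z in A i, f z ∂σ ≠ 0
    swap
    · exact ⟨0, fun h1 h2 => absurd ⟨h1, h2⟩ hi⟩
    have hσ0 : σ (A i) ≠ 0 := fun h => hi.2 (hI0 i h)
    have hσt := hσ i hi.1
    obtain ⟨k, h1, h2⟩ := ENNReal.exists_mem_Ioc_zpow
      (x := (∫⁻ z in A i, f z ∂σ) / σ (A i)) (y := 2)
      (ENNReal.div_pos hi.2 hσt).ne' (ENNReal.div_lt_top (hItop i hi.1) hσ0).ne
      (by norm_num) (by norm_num)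
    refine ⟨k, fun _ _ => ⟨?_, ?_⟩⟩
    · exact (ENNReal.lt_div_iff_mul_lt (Or.inl hσ0) (Or.inl hσt)).1 h1
    · exact (ENNReal.div_le_iff hσ0 hσt).1 h2
  choose κ hκ using hlevel
  -- the maximal sets at each level
  set B : ℤ → Finset ι := fun k =>
    F.filter fun i => (2 : ℝ≥0∞) ^ k * σ (A i) < ∫⁻ z in A i, f z ∂σ with hB
  set M : ℤ → Finset ι := fun k =>
    (B k).filter fun i => ∀ j ∈ B k, A i ⊆ A j → i = j with hM
  have hMB : ∀ k, ∀ i ∈ M k, i ∈ B k := fun k i hi => (Finset.mem_filter.1 hi).1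
  have hMF : ∀ k, ∀ i ∈ M k, i ∈ F := fun k i hi => (Finset.mem_filter.1 (hMB k i hi)).1
  have hmax : ∀ k, ∀ i ∈ B k, ∃ R ∈ M k, A i ⊆ A R := by
    intro k i hi
    obtain ⟨s, his, hs, hsmax⟩ := ((B k).image A).exists_le_maximal (Finset.mem_image_of_mem A hi)
    obtain ⟨R, hR, rfl⟩ := Finset.mem_image.1 hs
    refine ⟨R, Finset.mem_filter.2 ⟨hR, fun j hj hRj => ?_⟩, his⟩
    exact hinj (Finset.mem_filter.1 hR).1 (Finset.mem_filter.1 hj).1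
      (subset_antisymm hRj (hsmax (Finset.mem_image_of_mem A hj) hRj))
  set K : Finset ℤ := F.image κ with hK
  set P : Finset (Σ _ : ℤ, ι) := K.sigma M with hP
  set u : (Σ _ : ℤ, ι) → α → ℝ≥0∞ := fun i y => ((2 : ℝ≥0∞) ^ (i.1 + 1)) ^ r * G i.2 y with hu
  have hum : ∀ i ∈ P, Measurable (u i) := fun i _ => (hGm i.2).const_mul _
  set x : (Σ _ : ℤ, ι) → ℝ≥0∞ := fun i => ((2 : ℝ≥0∞) ^ (i.1 + 1)) ^ p * σ (A i.2) with hx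
  have hux : ∀ i ∈ P, (∫⁻ y, u i y ^ (q / r) ∂ω) ^ (1 / (q / r)) ≤ T * x i ^ (r / p) := by
    rintro ⟨k, R⟩ hi
    have hR : R ∈ F := hMF k R (Finset.mem_sigma.1 hi).2
    simp only [hu, hx]
    simp_rw [ENNReal.mul_rpow_of_nonneg _ _ hs0.le]
    rw [lintegral_const_mul _ ((hGm R).pow_const _),
      ENNReal.mul_rpow_of_nonneg _ _ (by positivity), ← ENNReal.rpow_mul,
      mul_one_div_cancel hs0.ne', ENNReal.rpow_one,
      ENNReal.mul_rpow_of_nonneg _ _ (by positivity), ← ENNReal.rpow_mul,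
      mul_div_cancel₀ r hp0.ne', mul_left_comm]
    gcongr
    exact hT R hR
  have hpoint : ∀ y, ∑ i ∈ F, (A i).indicator (fun _ => c i * (∫⁻ z in A i, f z ∂σ) ^ r) y
      ≤ ∑ i ∈ P, u i y := by
    intro y
    have hswap : ∑ i ∈ P, u i y = ∑ j ∈ F, ∑ i ∈ P, ((2 : ℝ≥0∞) ^ (i.1 + 1)) ^ r *
        {j | A j ⊆ A i.2}.indicator
          (fun j => (A j).indicator (fun _ => c j * σ (A j) ^ r) y) j := by
      rw [Finset.sum_comm]
      simp only [hu, hG, Finset.mul_sum]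
    rw [hswap]
    refine Finset.sum_le_sum fun j hj => ?_
    by_cases hyj : y ∈ A j
    swap
    · simp [hyj]
    by_cases hIj : ∫⁻ z in A j, f z ∂σ = 0
    · simp [hIj, hr0]
    obtain ⟨h1, h2⟩ := hκ j hj hIj
    obtain ⟨R, hR, hjR⟩ := hmax (κ j) j (Finset.mem_filter.2 ⟨hj, h1⟩)
    have hmem : (⟨κ j, R⟩ : Σ _ : ℤ, ι) ∈ P :=
      Finset.mem_sigma.2 ⟨Finset.mem_image_of_mem κ hj, hR⟩
    refine le_trans ?_ (Finset.single_le_sum (fun _ _ => zero_le) hmem)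
    simp only [Set.mem_ofPred_eq, hjR, Set.indicator_of_mem, hyj]
    rw [mul_left_comm, ← ENNReal.mul_rpow_of_nonneg _ _ hr0.le]
    gcongr
  have hsum : ∑ i ∈ P, x i ≤
      (4 : ℝ≥0∞) ^ p * (1 - (2⁻¹ : ℝ≥0∞) ^ (p - 1))⁻¹ * ∫⁻ y, f y ^ p ∂σ := by
    have hd : ∀ k, (M k : Set ι).Pairwise fun i j => AEDisjoint σ (A i) (A j) := by
      intro k i hi j hj hij
      rcases hnest i (hMF k i hi) j (hMF k j hj) with h | h | h
      · exact absurd ((Finset.mem_filter.1 hi).2 j (hMB k j hj) h) hij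
      · exact absurd ((Finset.mem_filter.1 hj).2 i (hMB k i hi) h).symm hij
      · exact h
    have hcar := sum_level_measure_le hp K M hf (fun k i hi => hA i (hMF k i hi))
      (fun k i hi => hσ i (hMF k i hi)) hd
      (fun k i hi => (Finset.mem_filter.1 (hMB k i hi)).2.le)
    have h4 : ∀ k : ℤ, ((2 : ℝ≥0∞) ^ (k + 1)) ^ p = 4 ^ p * ((2 : ℝ≥0∞) ^ (k - 1)) ^ p := by
      intro k
      rw [← ENNReal.mul_rpow_of_nonneg _ _ hp0.le]
      congr 1
      have := ENNReal.zpow_add (x := 2) (by norm_num) (by norm_num) 2 (k - 1)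
      rw [show (2 : ℤ) + (k - 1) = k + 1 by ring] at this
      rw [this]
      congr 1
      norm_cast
    calc _ = 4 ^ p * ∑ k ∈ K, ∑ i ∈ M k, ((2 : ℝ≥0∞) ^ (k - 1)) ^ p * σ (A i) := by
          rw [hP, Finset.sum_sigma]
          simp only [hx, h4, Finset.mul_sum, mul_assoc]
      _ ≤ _ := by
          rw [mul_assoc]
          gcongr
  calc _ ≤ (∫⁻ y, (∑ i ∈ P, u i y) ^ (q / r) ∂ω) ^ (1 / (q / r)) := by
        gcongr with y
        exact hpoint y
    _ ≤ T * (∑ i ∈ P, x i) ^ (r / p) :=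
        lintegral_rpow_sum_le_of_forall_le hp hpq hpr P hum T x hux
    _ ≤ T * ((4 : ℝ≥0∞) ^ p * (1 - (2⁻¹ : ℝ≥0∞) ^ (p - 1))⁻¹ * ∫⁻ y, f y ^ p ∂σ) ^ (r / p) := by
        gcongr
    _ = _ := by
        rw [ENNReal.mul_rpow_of_nonneg _ (∫⁻ y, f y ^ p ∂σ) (by positivity), ← mul_assoc,
          mul_comm T]

namespace Cube

variable {n : ℕ}

theorem carrier_eq_Icc (Q : Cube n) :
    Q.carrier = Set.Icc Q.corner (fun i => Q.corner i + Q.side) := by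
  ext x
  simp only [carrier, Set.mem_ofPred_eq, Set.mem_Icc, Pi.le_def, forall_and]

theorem isCompact_carrier (Q : Cube n) : IsCompact Q.carrier := by
  rw [carrier_eq_Icc]
  exact isCompact_Icc

theorem measurableSet_carrier (Q : Cube n) : MeasurableSet Q.carrier :=
  Q.isCompact_carrier.measurableSet

theorem carrier_injective (hn : 1 ≤ n) : Function.Injective (carrier (n := n)) := by
  intro Q Q' h
  have hne : Q.corner ≤ fun i => Q.corner i + Q.side := fun i => by
    have := Q.side_pos
    simp only
    linarith
  rw [carrier_eq_Icc, carrier_eq_Icc] at h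
  have hne' : Q'.corner ≤ fun i => Q'.corner i + Q'.side := fun i => by
    have := Q'.side_pos
    simp only
    linarith
  have h1 := (Set.Icc_subset_Icc_iff hne).1 h.subset
  have h2 := (Set.Icc_subset_Icc_iff hne').1 h.symm.subset
  have hc : Q.corner = Q'.corner := le_antisymm h2.1 h1.1
  have hs := congrFun (le_antisymm h1.2 h2.2) ⟨0, hn⟩
  replace hs : Q.side = Q'.side := by
    simp only [hc] at hs
    linarith
  cases Q
  cases Q'
  simp only at hc hs
  subst hc hs
  rfl

theorem countable_isDyadic : {Q : Cube n | Q.IsDyadic}.Countable := by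
  refine (Set.countable_range (fun t : ℤ × (Fin n → ℤ) =>
    (⟨fun i => (t.2 i : ℝ) * (2 : ℝ) ^ (-t.1), (2 : ℝ) ^ (-t.1), by positivity⟩ : Cube n))).mono ?_
  rintro ⟨a, s, hs⟩ ⟨j, m, h1, h2⟩
  refine ⟨(j, m), ?_⟩
  simp only at h1 h2
  subst h1
  obtain rfl : a = fun i => (m i : ℝ) * (2 : ℝ) ^ (-j) := funext h2
  rfl

/-- Two half-open dyadic intervals that meet are nested. -/
theorem dyadic_interval_subset {j j' m m' : ℤ} (hj : j' ≤ j) {x : ℝ}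
    (h1 : (m : ℝ) * 2 ^ (-j) ≤ x) (h2 : x < m * 2 ^ (-j) + 2 ^ (-j))
    (h1' : (m' : ℝ) * 2 ^ (-j') ≤ x) (h2' : x < m' * 2 ^ (-j') + 2 ^ (-j')) :
    (m' : ℝ) * 2 ^ (-j') ≤ m * 2 ^ (-j) ∧
      (m : ℝ) * 2 ^ (-j) + 2 ^ (-j) ≤ m' * 2 ^ (-j') + 2 ^ (-j') := by
  obtain ⟨N, rfl⟩ : ∃ N : ℕ, j = j' + N := ⟨(j - j').toNat, by omega⟩
  have hd : (0 : ℝ) < 2 ^ (-(j' + N : ℤ)) := by positivity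
  have hD : (2 : ℝ) ^ (-j') = ((2 ^ N : ℤ) : ℝ) * 2 ^ (-(j' + N : ℤ)) := by
    push_cast
    rw [← zpow_natCast, ← zpow_add₀ (by norm_num)]
    congr 1
    ring
  rw [hD] at h1' h2' ⊢
  set d : ℝ := 2 ^ (-(j' + N : ℤ))
  have e1 : m' * 2 ^ N < m + 1 := by
    have : ((m' * 2 ^ N : ℤ) : ℝ) * d < ((m + 1 : ℤ) : ℝ) * d := by
      push_cast at *
      linarith
    exact_mod_cast lt_of_mul_lt_mul_right this hd.le
  have e2 : m < m' * 2 ^ N + 2 ^ N := by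
    have : (m : ℝ) * d < ((m' * 2 ^ N + 2 ^ N : ℤ) : ℝ) * d := by
      push_cast at *
      linarith
    exact_mod_cast lt_of_mul_lt_mul_right this hd.le
  have e1' : ((m' * 2 ^ N : ℤ) : ℝ) * d ≤ m * d :=
    mul_le_mul_of_nonneg_right (by exact_mod_cast Int.lt_add_one_iff.1 e1) hd.le
  have e2' : ((m + 1 : ℤ) : ℝ) * d ≤ ((m' * 2 ^ N + 2 ^ N : ℤ) : ℝ) * d :=
    mul_le_mul_of_nonneg_right (by exact_mod_cast e2) hd.le
  push_cast at *
  constructor <;> linarith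

theorem IsDyadic.subset_or_subset_or_aedisjoint {Q Q' : Cube n} (hQ : Q.IsDyadic)
    (hQ' : Q'.IsDyadic) :
    Q.carrier ⊆ Q'.carrier ∨ Q'.carrier ⊆ Q.carrier ∨
      AEDisjoint volume Q.carrier Q'.carrier := by
  wlog h : Q.side ≤ Q'.side generalizing Q Q'
  · rcases this hQ' hQ (le_of_not_ge h) with h | h | h
    · exact Or.inr (Or.inl h)
    · exact Or.inl h
    · exact Or.inr (Or.inr h.symm)
  obtain ⟨j, m, hs, hc⟩ := hQ
  obtain ⟨j', m', hs', hc'⟩ := hQ'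
  have hj : j' ≤ j := by
    rw [hs, hs'] at h
    have := (zpow_le_zpow_iff_right₀ (by norm_num : (1 : ℝ) < 2)).1 h
    omega
  let H : Cube n → Set (Fin n → ℝ) := fun Q =>
    Set.univ.pi fun i => Set.Ico (Q.corner i) (Q.corner i + Q.side)
  have hH : ∀ Q : Cube n, H Q =ᵐ[volume] Q.carrier := fun Q => by
    rw [carrier_eq_Icc]
    exact Measure.univ_pi_Ico_ae_eq_Icc
  by_cases hdisj : Disjoint (H Q) (H Q')
  · exact Or.inr (Or.inr (hdisj.aedisjoint.congr (hH Q).symm (hH Q').symm))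
  · left
    obtain ⟨x, hx, hx'⟩ := Set.not_disjoint_iff.1 hdisj
    intro y hy i
    have h1 : x i ∈ Set.Ico (Q.corner i) (Q.corner i + Q.side) := hx i trivial
    have h2 : x i ∈ Set.Ico (Q'.corner i) (Q'.corner i + Q'.side) := hx' i trivial
    have h3 := hy i
    rw [hs, hc i] at h1 h3
    rw [hs', hc' i] at h2
    rw [hs', hc' i]
    have := dyadic_interval_subset hj h1.1 h1.2 h2.1 h2.2
    constructor <;> linarith

end Cube

section Weights

variable {n : ℕ} {w : (Fin n → ℝ) → ℝ}

theorem IsWeight.aemeasurable (hw : IsWeight w) :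
    AEMeasurable (fun x => ENNReal.ofReal (w x)) volume :=
  hw.1.aestronglyMeasurable.aemeasurable.ennreal_ofReal

theorem wMass_eq_withDensity (w : (Fin n → ℝ) → ℝ) (Q : Cube n) :
    wMass w Q = volume.withDensity (fun x => ENNReal.ofReal (w x)) Q.carrier := by
  rw [withDensity_apply _ Q.measurableSet_carrier, wMass]

theorem IsWeight.wMass_ne_top (hw : IsWeight w) (Q : Cube n) : wMass w Q ≠ ⊤ :=
  (hw.1.integrableOn_isCompact Q.isCompact_carrier).lintegral_lt_top.ne

theorem IsWeight.eNorm_eq (hw : IsWeight w) (s : ℝ) {g : (Fin n → ℝ) → ℝ≥0∞} (hg : Measurable g) :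
    eNorm s w g =
      (∫⁻ x, g x ^ s ∂volume.withDensity (fun x => ENNReal.ofReal (w x))) ^ (1 / s) := by
  rw [lintegral_withDensity_eq_lintegral_mul₀ hw.aemeasurable (hg.pow_const s).aemeasurable, eNorm]
  simp only [Pi.mul_apply, mul_comm]

theorem IsWeight.wNorm_rpow_eq (hw : IsWeight w) {p : ℝ} (hp : 0 < p) (r : ℝ)
    {f : (Fin n → ℝ) → ℝ} (hf : Measurable f) (hf0 : ∀ x, 0 ≤ f x) :
    wNorm p w f ^ r = (∫⁻ x, ENNReal.ofReal (f x) ^ p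
      ∂volume.withDensity (fun x => ENNReal.ofReal (w x))) ^ (r / p) := by
  rw [lintegral_withDensity_eq_lintegral_mul₀ hw.aemeasurable
    (hf.ennreal_ofReal.pow_const p).aemeasurable, wNorm, ← ENNReal.rpow_mul, one_div_mul_eq_div]
  congr 2 with x
  rw [abs_of_nonneg (hf0 x), ← ENNReal.ofReal_rpow_of_nonneg (hf0 x) hp.le, Pi.mul_apply, mul_comm]

theorem IsWeight.setLIntegral_mul_eq (hw : IsWeight w) {f : (Fin n → ℝ) → ℝ} (hf : Measurable f)
    (hf0 : ∀ x, 0 ≤ f x) (Q : Cube n) :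
    ∫⁻ y in Q.carrier, ENNReal.ofReal (f y * w y) = ∫⁻ y in Q.carrier, ENNReal.ofReal (f y)
      ∂volume.withDensity (fun x => ENNReal.ofReal (w x)) := by
  rw [setLIntegral_withDensity_eq_lintegral_mul₀ hw.aemeasurable hf.ennreal_ofReal.aemeasurable
    Q.measurableSet_carrier]
  refine lintegral_congr fun y => ?_
  rw [ENNReal.ofReal_mul (hf0 y), Pi.mul_apply, mul_comm]

/-- By monotone convergence, a bound on finite partial sums gives a bound on `cubeSum`. -/
theorem IsWeight.eNorm_cubeSum_le (hw : IsWeight w) {s : ℝ} (hs : 0 < s) {D : Set (Cube n)}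
    (hD : D.Countable) (g : Cube n → ℝ≥0∞) (b : ℝ≥0∞)
    (h : ∀ F : Finset D, (∫⁻ x, (∑ Q ∈ F, Q.1.carrier.indicator (fun _ => g Q.1) x) ^ s
      ∂volume.withDensity (fun x => ENNReal.ofReal (w x))) ^ (1 / s) ≤ b) :
    eNorm s w (cubeSum D g) ≤ b := by
  have := hD.to_subtype
  have hm : ∀ F : Finset D,
      Measurable fun x => ∑ Q ∈ F, Q.1.carrier.indicator (fun _ => g Q.1) x := fun F =>
    Finset.measurable_sum F fun Q _ => measurable_const.indicator Q.1.measurableSet_carrier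
  have hsum : cubeSum D g =
      fun x => ⨆ F : Finset D, ∑ Q ∈ F, Q.1.carrier.indicator (fun _ => g Q.1) x :=
    funext fun x => ENNReal.tsum_eq_iSup_sum
  rw [hw.eNorm_eq s (by rw [hsum]; exact Measurable.iSup hm), one_div, ENNReal.rpow_inv_le_iff hs,
    hsum]
  have hpow : ∀ x, (⨆ F : Finset D, ∑ Q ∈ F, Q.1.carrier.indicator (fun _ => g Q.1) x) ^ s =
      ⨆ F : Finset D, (∑ Q ∈ F, Q.1.carrier.indicator (fun _ => g Q.1) x) ^ s := fun x =>
    (ENNReal.orderIsoRpow s hs).map_iSup _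
  simp_rw [hpow]
  rw [lintegral_iSup_directed_of_measurable fun F => (hm F).pow_const s]
  · refine iSup_le fun F => ?_
    rw [← ENNReal.rpow_inv_le_iff hs, ← one_div]
    exact h F
  · refine Monotone.directed_le fun F F' hFF' x => ?_
    exact ENNReal.rpow_le_rpow (Finset.sum_le_sum_of_subset hFF') hs.le

end Weights

/-- reduction by principal cubes, for `r ≥ p`: the weighted `L^{q/r}_ω` norm of
`Σ_{Q∈S} c_Q (∫_Q fσ)^r 1_Q` is controlled by the testing supremum times `‖f‖^r_{L^p_σ}`,
with a constant depending only on `p`, `q`, `r`. -/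
theorem stmt5 (p q r : ℝ) (hp : 1 < p) (hpq : p ≤ q) (hpr : p ≤ r) :
    ∃ C : ℝ, 0 < C ∧
      ∀ (n : ℕ), 1 ≤ n →
      ∀ η : ℝ, 0 < η → η ≤ 1 →
      ∀ (S : Set (Cube n)), (∀ Q ∈ S, Q.IsDyadic) → IsSparse η S →
      ∀ ω σ' : (Fin n → ℝ) → ℝ, IsWeight ω → IsWeight σ' →
      ∀ c : Cube n → ℝ, (∀ Q, 0 ≤ c Q) →
      ∀ f : (Fin n → ℝ) → ℝ, Measurable f → (∀ x, 0 ≤ f x) →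
        eNorm (q / r) ω
            (cubeSum S fun Q =>
              ENNReal.ofReal (c Q) * (∫⁻ y in Q.carrier, ENNReal.ofReal (f y * σ' y)) ^ r) ≤
          ENNReal.ofReal C *
            (⨆ R ∈ S, wMass σ' R ^ (-(r / p)) *
              eNorm (q / r) ω
                (cubeSum {Q | Q ∈ S ∧ Q.carrier ⊆ R.carrier} fun Q =>
                  ENNReal.ofReal (c Q) * wMass σ' Q ^ r)) *
            wNorm p σ' f ^ r := by
  have hp0 : 0 < p := by linarith
  have hr0 : 0 < r := by linarith
  have hs0 : 0 < q / r := div_pos (by linarith) hr0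
  set C : ℝ≥0∞ := ((4 : ℝ≥0∞) ^ p * (1 - (2⁻¹ : ℝ≥0∞) ^ (p - 1))⁻¹) ^ (r / p) with hC
  have hCtop : C ≠ ⊤ := by
    refine ENNReal.rpow_ne_top_of_nonneg (by positivity) (ENNReal.mul_ne_top ?_ ?_)
    · exact ENNReal.rpow_ne_top_of_nonneg hp0.le (by norm_num)
    · rw [ENNReal.inv_ne_top, ← pos_iff_ne_zero, tsub_pos_iff_lt]
      exact ENNReal.rpow_lt_one (by simp) (by linarith)
  refine ⟨C.toReal + 1, by positivity, ?_⟩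
  intro n hn η _ _ S hS _ ω σ' hω hσ' c _ f hf hf0
  have hScount : S.Countable := Cube.countable_isDyadic.mono hS
  set T : ℝ≥0∞ := ⨆ R ∈ S, wMass σ' R ^ (-(r / p)) *
    eNorm (q / r) ω (cubeSum {Q | Q ∈ S ∧ Q.carrier ⊆ R.carrier} fun Q =>
      ENNReal.ofReal (c Q) * wMass σ' Q ^ r) with hT
  refine hω.eNorm_cubeSum_le hs0 hScount _ _ fun F => ?_
  have hCle : C ≤ ENNReal.ofReal (C.toReal + 1) := by
    conv_lhs => rw [← ENNReal.ofReal_toReal hCtop]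
    exact ENNReal.ofReal_le_ofReal (by linarith)
  rw [hσ'.wNorm_rpow_eq hp0 r hf hf0]
  simp_rw [hσ'.setLIntegral_mul_eq hf hf0]
  refine le_trans ?_ (mul_le_mul_left (mul_le_mul_left hCle T) _)
  refine testing_bound_of_finset hp hpq hpr F (A := fun Q : S => Q.1.carrier)
    (fun Q _ => Q.1.measurableSet_carrier)
    (fun Q _ Q' _ h => Subtype.ext (Cube.carrier_injective hn h))
    (fun Q _ => by rw [← wMass_eq_withDensity]; exact hσ'.wMass_ne_top Q.1)
    (fun Q _ Q' _ => ?_) (fun Q => ENNReal.ofReal (c Q.1)) hf.ennreal_ofReal T ?_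
  · rcases (hS _ Q.2).subset_or_subset_or_aedisjoint (hS _ Q'.2) with h | h | h
    · exact Or.inl h
    · exact Or.inr (Or.inl h)
    · exact Or.inr (Or.inr (withDensity_absolutelyContinuous _ _ h))
  intro R hR
  simp only [← wMass_eq_withDensity]
  set D : Set (Cube n) := {Q | Q ∈ S ∧ Q.carrier ⊆ R.1.carrier} with hD
  set g : Cube n → ℝ≥0∞ := fun Q => ENNReal.ofReal (c Q) * wMass σ' Q ^ r with hg
  have hle : ∀ y, ∑ i ∈ F, {i : S | i.1.carrier ⊆ R.1.carrier}.indicator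
      (fun i => i.1.carrier.indicator (fun _ => g i.1) y) i ≤ cubeSum D g y := by
    intro y
    have h1 : cubeSum D g y = ∑' Q, D.indicator (fun Q => Q.carrier.indicator (fun _ => g Q) y) Q :=
      tsum_subtype D fun Q => Q.carrier.indicator (fun _ => g Q) y
    rw [h1]
    refine le_trans ?_ (ENNReal.tsum_comp_le_tsum_of_injective
      (Subtype.val_injective (p := fun Q => Q ∈ S)) _)
    refine le_trans (Finset.sum_le_sum fun i _ => ?_) (ENNReal.sum_le_tsum F)
    by_cases hi : i.1.carrier ⊆ R.1.carrier
    · have hiD : i.1 ∈ D := ⟨i.2, hi⟩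
      simp [hi, hiD]
    · simp [hi]
  have hcm : Measurable (cubeSum D g) := by
    have : Countable D := (hScount.mono fun Q hQ => hQ.1).to_subtype
    exact Measurable.tsum fun Q => measurable_const.indicator Q.1.measurableSet_carrier
  calc _ ≤ eNorm (q / r) ω (cubeSum D g) := by
        rw [hω.eNorm_eq _ hcm]
        gcongr with y
        exact hle y
    _ ≤ T * wMass σ' R.1 ^ (r / p) := by
        rcases eq_or_ne (wMass σ' R.1) 0 with h0 | h0
        · have hz : cubeSum D g = fun _ => 0 := by
            funext y
            refine ENNReal.tsum_eq_zero.2 fun Q => ?_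
            have : wMass σ' Q.1 = 0 := by
              rw [wMass_eq_withDensity] at h0 ⊢
              exact measure_mono_null Q.2.2 h0
            simp [hg, this, hr0]
          rw [hz]
          simp [eNorm, hs0, hr0, show 0 < q by linarith]
        · have h1 : wMass σ' R.1 ^ (-(r / p)) * eNorm (q / r) ω (cubeSum D g) ≤ T :=
            le_iSup₂_of_le R.1 R.2 le_rfl
          refine le_trans ?_ (mul_le_mul_left h1 _)
          rw [mul_right_comm, ← ENNReal.rpow_add _ _ h0 (hσ'.wMass_ne_top R.1), neg_add_cancel,
            ENNReal.rpow_zero, one_mul]
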